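/- Let f ∈ Cvx₀(ℝⁿ) and x ∈ int(dom(f)) with f(x) ≠ 0, and assume f is not linear on [0,x+]. Then ∂°f(x) = ∂(Jf)(x/f(x)), and ∂°(Jf)(x/f(x)) = ∂f(x). -/

import Mathlib

open scoped ENNReal RealInnerProductSpace
open Set

noncomputable section

/-- Euclidean space `ℝⁿ`. -/
abbrev Euc (n : ℕ) := EuclideanSpace ℝ (Fin n)

/-- The polarity transform `𝒫`:
`(Pf)(y) = inf {c ≥ 0 : ⟨x,y⟩ ≤ 1 + c·f(x) for all x}`, with `inf ∅ = ∞`.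
(Nonnegativity of `c` is automatic since we work in `ℝ≥0∞`.) -/
def polarT {n : ℕ} (f : Euc n → ℝ≥0∞) (y : Euc n) : ℝ≥0∞ :=
  sInf {c : ℝ≥0∞ | ∀ x : Euc n, ENNReal.ofReal ⟪x, y⟫ ≤ 1 + c * f x}

/-- The class `Cvx₀(ℝⁿ)` of geometric convex functions: lower semicontinuous, convex,
nonnegative (automatic), vanishing at the origin. -/
def GeomConvexOn {n : ℕ} (f : Euc n → ℝ≥0∞) : Prop :=
  (∀ x y : Euc n, ∀ a b : ℝ, 0 ≤ a → 0 ≤ b → a + b = 1 →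
    f (a • x + b • y) ≤ ENNReal.ofReal a * f x + ENNReal.ofReal b * f y) ∧
  LowerSemicontinuous f ∧ f 0 = 0

/-- The polar set `K° = {y : ⟨x,y⟩ ≤ 1 ∀ x ∈ K}`. -/
def polarSet {n : ℕ} (K : Set (Euc n)) : Set (Euc n) :=
  {y : Euc n | ∀ x ∈ K, ⟪x, y⟫ ≤ 1}

/-- The Legendre transform `(Lf)(y) = sup_x (⟨x,y⟩ - f(x))` of a `[0,∞]`-valued function,
with values in `[0,∞]` (for `f` with `f(0) = 0` the supremum is automatically `≥ 0`,
so the `ℝ≥0∞`-valued truncated subtraction computes the genuine Legendre transform). -/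
def legendreT {n : ℕ} (f : Euc n → ℝ≥0∞) (y : Euc n) : ℝ≥0∞ :=
  ⨆ x : Euc n, ENNReal.ofReal ⟪x, y⟫ - f x

/-- The usual subdifferential `∂g(x) = {y : g(z) ≥ g(x) + ⟨z - x, y⟩ ∀ z}`,
stated in `EReal` to accommodate `[0,∞]`-valued functions. -/
def subdiff {n : ℕ} (g : Euc n → ℝ≥0∞) (x : Euc n) : Set (Euc n) :=
  {y : Euc n | ∀ z : Euc n, (g x : EReal) + ((⟪z - x, y⟫ : ℝ) : EReal) ≤ (g z : EReal)}

/-- The polar subdifferential `∂°f(x) = {y ∈ dom(Pf) : Pf(y)·f(x) = ⟨x,y⟩ - 1}`. -/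
def polarSubdiff {n : ℕ} (f : Euc n → ℝ≥0∞) (x : Euc n) : Set (Euc n) :=
  {y : Euc n | polarT f y ≠ ∞ ∧
    (polarT f y : EReal) * (f x : EReal) = ((⟪x, y⟫ - 1 : ℝ) : EReal)}

/-- `g` restricted to the segment `[0,x]` is linear (i.e. `g(t•x) = c·t` for `t ∈ [0,1]`). -/
def RayLinear {n : ℕ} (g : Euc n → ℝ≥0∞) (x : Euc n) : Prop :=
  ∃ c : ℝ, 0 ≤ c ∧ ∀ t : ℝ, t ∈ Icc (0:ℝ) 1 → g (t • x) = ENNReal.ofReal (c * t)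

/-- `g` is not linear on `[0,x+]`: there is no `t > 1` such that `g` is linear on `[0,t•x]`. -/
def NotLinearPlus {n : ℕ} (g : Euc n → ℝ≥0∞) (x : Euc n) : Prop :=
  ¬ ∃ t : ℝ, 1 < t ∧ RayLinear g (t • x)

/-- `f` is nonlinear at infinity: for every ray `ℝ⁺x`, `t ↦ f(tx)` is finite everywhere and
is not squeezed between `at - b` and `at` for any `a ≥ 0`, `b > 0`. -/
def NonlinearAtInfinity {n : ℕ} (f : Euc n → ℝ≥0∞) : Prop :=
  ∀ x : Euc n, x ≠ 0 →
    (∀ t : ℝ, 0 ≤ t → f (t • x) ≠ ∞) ∧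
    ¬ ∃ a b : ℝ, 0 ≤ a ∧ 0 < b ∧ ∀ t : ℝ, 0 ≤ t →
        ENNReal.ofReal (a * t - b) ≤ f (t • x) ∧ f (t • x) ≤ ENNReal.ofReal (a * t)

/-- The class `S₁(ℝⁿ)`: geometric convex functions which are finite-valued, continuously
differentiable off the origin, and strictly convex. -/
def S1 {n : ℕ} (f : Euc n → ℝ≥0∞) : Prop :=
  GeomConvexOn f ∧ (∀ x, f x ≠ ∞) ∧
  ContDiffOn ℝ 1 (fun x => (f x).toReal) ({0}ᶜ : Set (Euc n)) ∧
  StrictConvexOn ℝ (univ : Set (Euc n)) (fun x => (f x).toReal)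

/-- The Hessian of a real-valued function, as the derivative of the gradient map. -/
def hess {n : ℕ} (g : Euc n → ℝ) (x : Euc n) : Euc n →L[ℝ] Euc n :=
  fderiv ℝ (fun z => gradient g z) x

/-- The class `S₂(ℝⁿ)`: geometric convex functions which are finite-valued, strictly convex,
twice continuously differentiable off the origin with positive definite Hessian there. -/
def S2 {n : ℕ} (f : Euc n → ℝ≥0∞) : Prop :=
  GeomConvexOn f ∧ (∀ x, f x ≠ ∞) ∧
  StrictConvexOn ℝ (univ : Set (Euc n)) (fun x => (f x).toReal) ∧
  ContDiffOn ℝ 2 (fun x => (f x).toReal) ({0}ᶜ : Set (Euc n)) ∧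
  ∀ x : Euc n, x ≠ 0 → ∀ v : Euc n, v ≠ 0 →
    0 < ⟪v, hess (fun z => (f z).toReal) x v⟫

open Topology

/-- A convex function on a finite-dimensional inner product space has a subgradient at every
interior point of its domain. -/
theorem ConvexOn.exists_subgradient {E : Type*} [NormedAddCommGroup E] [InnerProductSpace ℝ E]
    [FiniteDimensional ℝ E] {s : Set E} {φ : E → ℝ} (hφ : ConvexOn ℝ s φ) {x : E}
    (hx : x ∈ interior s) : ∃ p : E, ∀ w ∈ s, φ x + ⟪w - x, p⟫ ≤ φ w := by
  have hφi : ConvexOn ℝ (interior s) φ := hφ.subset interior_subset hφ.1.interior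
  have hopen : IsOpen {q : E × ℝ | q.1 ∈ interior s ∧ φ q.1 < q.2} := by
    have hc : ContinuousOn (fun q : E × ℝ => q.2 - φ q.1) (Prod.fst ⁻¹' interior s) :=
      continuousOn_snd.sub (hφ.continuousOn_interior.comp continuousOn_fst fun _ hq => hq)
    have h := hc.isOpen_inter_preimage (isOpen_interior.preimage continuous_fst)
      (isOpen_Ioi (a := (0 : ℝ)))
    convert h using 1
    ext q
    exact and_congr_right fun _ => sub_pos.symm
  obtain ⟨l, hl⟩ := geometric_hahn_banach_open_point hφi.convex_strict_epigraph hopen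
    (x := (x, φ x)) (by simp)
  set β : ℝ := l (0, 1) with hβ
  have hsplit : ∀ (w : E) (r : ℝ), l (w, r) = l (w, 0) + r * β := fun w r => by
    rw [hβ, ← smul_eq_mul, ← map_smul, ← map_add]
    simp
  have hβneg : β < 0 := by
    have h := hl (x, φ x + 1) ⟨hx, by simp⟩
    rw [hsplit, hsplit x (φ x)] at h
    linarith
  set p : E := (-β)⁻¹ • (InnerProductSpace.toDual ℝ E).symm (l.comp (.inl ℝ E ℝ)) with hp
  have hinner : ∀ w, ⟪w, p⟫ = (-β)⁻¹ * l (w, 0) := fun w => by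
    rw [hp, real_inner_smul_right, real_inner_comm, InnerProductSpace.toDual_symm_apply]
    simp
  have hloc : ∀ w ∈ interior s, φ x + ⟪w - x, p⟫ ≤ φ w := fun w hw => by
    refine le_of_forall_pos_le_add fun ε hε => ?_
    have h := hl (w, φ w + ε) ⟨hw, by simpa using hε⟩
    rw [hsplit, hsplit x (φ x)] at h
    rw [inner_sub_left, hinner, hinner, ← mul_sub]
    have h' : (-β)⁻¹ * (l (w, 0) - l (x, 0)) ≤ φ w + ε - φ x := by
      rw [inv_mul_le_iff₀ (by linarith)]
      linarith
    linarith
  refine ⟨p, fun w hw => ?_⟩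
  have htend : Filter.Tendsto (fun t : ℝ => x + t • (w - x)) (𝓝[>] 0) (𝓝 x) := by
    have : Continuous fun t : ℝ => x + t • (w - x) := by fun_prop
    simpa using (this.tendsto 0).mono_left nhdsWithin_le_nhds
  obtain ⟨t, ⟨ht, ht0⟩, ht1⟩ := (((htend.eventually_mem (isOpen_interior.mem_nhds hx)).and
    self_mem_nhdsWithin).and (mem_nhdsWithin_of_mem_nhds (Iio_mem_nhds one_pos))).exists
  have h1 := hloc _ ht
  have h2 := hφ.2 (interior_subset hx) hw (by linarith : 0 ≤ 1 - t) ht0.le (by ring)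
  rw [show (1 - t) • x + t • w = x + t • (w - x) by module, smul_eq_mul, smul_eq_mul] at h2
  rw [add_sub_cancel_left, real_inner_smul_left] at h1
  refine le_of_mul_le_mul_left ?_ ht0
  linarith

section Transforms

variable {n : ℕ} {f : Euc n → ℝ≥0∞}

theorem inner_le_of_polarT_ne_top {y w : Euc n} (hy : polarT f y ≠ ∞) (hw : f w ≠ ∞) :
    ⟪w, y⟫ ≤ 1 + (polarT f y).toReal * (f w).toReal := by
  have key : ∀ ε : ℝ, 0 < ε → ⟪w, y⟫ ≤ 1 + ((polarT f y).toReal + ε) * (f w).toReal := by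
    intro ε hε
    have hlt : polarT f y < polarT f y + ENNReal.ofReal ε :=
      ENNReal.lt_add_right hy (by simpa using hε)
    obtain ⟨c, hc, hcl⟩ := sInf_lt_iff.1 hlt
    have hfin : polarT f y + ENNReal.ofReal ε ≠ ∞ := by finiteness
    have hct : c ≠ ∞ := hcl.ne_top
    have h := hc w
    have h2 : ⟪w, y⟫ ≤ (1 + c * f w).toReal :=
      (ENNReal.ofReal_le_iff_le_toReal (by finiteness)).1 h
    rw [ENNReal.toReal_add (by simp) (by finiteness), ENNReal.toReal_mul, ENNReal.toReal_one] at h2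
    have h3 : c.toReal ≤ (polarT f y).toReal + ε := by
      have := ENNReal.toReal_mono hfin hcl.le
      rwa [ENNReal.toReal_add hy (by simp), ENNReal.toReal_ofReal hε.le] at this
    have := mul_le_mul_of_nonneg_right h3 (ENNReal.toReal_nonneg (a := f w))
    linarith
  have hc : Continuous fun ε : ℝ => 1 + ((polarT f y).toReal + ε) * (f w).toReal := by fun_prop
  have ht := (hc.tendsto 0).mono_left (nhdsWithin_le_nhds (s := Ioi 0))
  rw [add_zero] at ht
  exact ge_of_tendsto ht (Filter.eventually_of_mem self_mem_nhdsWithin key)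

theorem polarT_le_ofReal {y : Euc n} {c : ℝ} (hc : 0 ≤ c)
    (h : ∀ w, f w ≠ ∞ → ⟪w, y⟫ ≤ 1 + c * (f w).toReal) : polarT f y ≤ ENNReal.ofReal c := by
  refine ENNReal.le_of_forall_pos_le_add fun ε hε _ => sInf_le fun w => ?_
  by_cases hw : f w = ∞
  · have : ENNReal.ofReal c + ε ≠ 0 := by simp [hε.ne']
    simp [hw, ENNReal.mul_top this]
  · have h1 : (1 : ℝ≥0∞) + ENNReal.ofReal c * f w ≤ 1 + (ENNReal.ofReal c + ε) * f w := by
      gcongr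
      exact le_self_add
    refine le_trans ?_ h1
    rw [ENNReal.ofReal_le_iff_le_toReal (by finiteness),
      ENNReal.toReal_add (by simp) (by finiteness), ENNReal.toReal_mul, ENNReal.toReal_one,
      ENNReal.toReal_ofReal hc]
    exact h w hw

theorem inner_sub_le_legendreT {y z : Euc n} (hy : f y ≠ ∞) (hz : legendreT f z ≠ ∞) :
    ⟪y, z⟫ - (f y).toReal ≤ (legendreT f z).toReal := by
  rw [← ENNReal.ofReal_le_iff_le_toReal hz, ENNReal.ofReal_sub _ ENNReal.toReal_nonneg,
    ENNReal.ofReal_toReal hy]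
  exact le_iSup (fun y => ENNReal.ofReal ⟪y, z⟫ - f y) y

theorem legendreT_le_ofReal {z : Euc n} {c : ℝ}
    (h : ∀ y, f y ≠ ∞ → ⟪y, z⟫ - (f y).toReal ≤ c) : legendreT f z ≤ ENNReal.ofReal c := by
  refine iSup_le fun y => ?_
  by_cases hy : f y = ∞
  · simp [hy]
  · rw [← ENNReal.ofReal_toReal hy, ← ENNReal.ofReal_sub _ ENNReal.toReal_nonneg]
    exact ENNReal.ofReal_le_ofReal (h y hy)

theorem legendreT_polarT_inv_smul_le {w : Euc n} {r : ℝ} (hr : 0 < r) (hw : f w ≠ ∞)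
    (hwr : (f w).toReal ≤ r) : legendreT (polarT f) (r⁻¹ • w) ≤ ENNReal.ofReal r⁻¹ := by
  refine legendreT_le_ofReal fun y hy => ?_
  have h := inner_le_of_polarT_ne_top hy hw
  have h2 := mul_le_mul_of_nonneg_left hwr (ENNReal.toReal_nonneg (a := polarT f y))
  rw [real_inner_smul_right, real_inner_comm, sub_le_iff_le_add, inv_mul_le_iff₀ hr, mul_add,
    mul_inv_cancel₀ hr.ne']
  linarith

theorem legendreT_zero : legendreT f 0 = 0 := by
  simp [legendreT]

theorem EReal.coe_ennreal_eq_coe_toReal {a : ℝ≥0∞} (ha : a ≠ ∞) :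
    (a : EReal) = ((a.toReal : ℝ) : EReal) := by
  rw [← EReal.toReal_coe_ennreal, EReal.coe_toReal (by simpa using ha) (by simp)]

theorem mem_subdiff_iff {x y : Euc n} (hx : f x ≠ ∞) :
    y ∈ subdiff f x ↔ ∀ z, f z ≠ ∞ → (f x).toReal + ⟪z - x, y⟫ ≤ (f z).toReal := by
  refine forall_congr' fun z => ?_
  by_cases hz : f z = ∞
  · simp [hz]
  · rw [EReal.coe_ennreal_eq_coe_toReal hx, EReal.coe_ennreal_eq_coe_toReal hz,
      ← EReal.coe_add, EReal.coe_le_coe_iff]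
    exact ⟨fun h _ => h, fun h => h hz⟩

theorem mem_polarSubdiff_iff {x y : Euc n} (hx : f x ≠ ∞) :
    y ∈ polarSubdiff f x ↔
      polarT f y ≠ ∞ ∧ (polarT f y).toReal * (f x).toReal = ⟪x, y⟫ - 1 := by
  refine and_congr_right fun hy => ?_
  rw [EReal.coe_ennreal_eq_coe_toReal hx, EReal.coe_ennreal_eq_coe_toReal hy,
    ← EReal.coe_mul, EReal.coe_eq_coe_iff]

theorem GeomConvexOn.convexOn_toReal (hf : GeomConvexOn f) :
    ConvexOn ℝ {z | f z ≠ ∞} fun z => (f z).toReal := by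
  have hfin : ∀ {u v : Euc n}, f u ≠ ∞ → f v ≠ ∞ → ∀ a b : ℝ,
      ENNReal.ofReal a * f u + ENNReal.ofReal b * f v ≠ ∞ := fun hu hv a b => by finiteness
  refine ⟨fun u hu v hv a b ha hb hab => ne_top_of_le_ne_top (hfin hu hv a b)
    (hf.1 u v a b ha hb hab), fun u hu v hv a b ha hb hab => ?_⟩
  rw [mem_ofPred_eq] at hu hv
  have h := ENNReal.toReal_mono (hfin hu hv a b) (hf.1 u v a b ha hb hab)
  rwa [ENNReal.toReal_add (by finiteness) (by finiteness), ENNReal.toReal_mul, ENNReal.toReal_mul,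
    ENNReal.toReal_ofReal ha, ENNReal.toReal_ofReal hb] at h

/-- If `f` is linear on no segment `[0, t • x]` with `t > 1`, then `f` grows strictly faster than
linearly past `x`. -/
theorem GeomConvexOn.mul_lt_of_notLinearPlus (hf : GeomConvexOn f) {x : Euc n}
    (hx : x ∈ interior {z | f z ≠ ∞}) (hlin : NotLinearPlus f x) {t : ℝ} (ht : 1 < t)
    (htx : f (t • x) ≠ ∞) : t * (f x).toReal < (f (t • x)).toReal := by
  by_contra! hle
  obtain ⟨p, hp⟩ := hf.convexOn_toReal.exists_subgradient hx
  have hf0 : f 0 = 0 := hf.2.2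
  have h0 := hp 0 (by simp [hf0])
  have h1 := hp _ htx
  simp only [hf0, ENNReal.toReal_zero, zero_sub, inner_neg_left] at h0
  rw [inner_sub_left, real_inner_smul_left] at h1
  have hxp : ⟪x, p⟫ = (f x).toReal := by nlinarith
  refine hlin ⟨t, ht, t * (f x).toReal, by positivity, fun s hs => ?_⟩
  have hup := hf.1 (t • x) 0 s (1 - s) hs.1 (by linarith [hs.2]) (by ring)
  rw [hf0, mul_zero, add_zero, smul_zero, add_zero] at hup
  have hne : f (s • t • x) ≠ ∞ := ne_top_of_le_ne_top (by finiteness) hup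
  have hup' := ENNReal.toReal_mono (by finiteness) hup
  rw [ENNReal.toReal_mul, ENNReal.toReal_ofReal hs.1] at hup'
  have hlow := hp _ hne
  rw [inner_sub_left, real_inner_smul_left, real_inner_smul_left, hxp] at hlow
  rw [← ENNReal.ofReal_toReal hne]
  congr 1
  have := mul_le_mul_of_nonneg_left hle hs.1
  linarith

theorem GeomConvexOn.le_legendreT_polarT (hf : GeomConvexOn f) {x : Euc n}
    (hx : x ∈ interior {z | f z ≠ ∞}) (hfx : f x ≠ 0) (hlin : NotLinearPlus f x)
    (hg : legendreT (polarT f) ((f x).toReal⁻¹ • x) ≠ ∞) :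
    (f x).toReal⁻¹ ≤ (legendreT (polarT f) ((f x).toReal⁻¹ • x)).toReal := by
  have hxt : f x ≠ ∞ := interior_subset hx
  have ha : 0 < (f x).toReal := ENNReal.toReal_pos hfx hxt
  set G := (legendreT (polarT f) ((f x).toReal⁻¹ • x)).toReal
  have htend : Filter.Tendsto (fun t : ℝ => t • x) (𝓝[>] 1) (𝓝 x) := by
    have : Continuous fun t : ℝ => t • x := by fun_prop
    simpa using (this.tendsto 1).mono_left nhdsWithin_le_nhds
  have hev : ∀ᶠ t : ℝ in 𝓝[>] 1, 2 - t ≤ (f x).toReal * G := by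
    filter_upwards [htend.eventually_mem (isOpen_interior.mem_nhds hx), self_mem_nhdsWithin]
      with t ht ht1
    have htx : f (t • x) ≠ ∞ := interior_subset ht
    obtain ⟨p, hp⟩ := hf.convexOn_toReal.exists_subgradient ht
    have hgrow := hf.mul_lt_of_notLinearPlus hx hlin ht1 htx
    simp only [mem_Ioi] at ht1
    have h1 := hp x hxt
    have h0 := hp 0 (by simp [hf.2.2])
    simp only [hf.2.2, ENNReal.toReal_zero, zero_sub, inner_neg_left, real_inner_smul_left] at h0
    rw [inner_sub_left, real_inner_smul_left] at h1
    set b := ⟪x, p⟫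
    set d := t * b - (f (t • x)).toReal with hd
    have hab : (f x).toReal < b := by nlinarith
    have hdb : b - (f x).toReal ≤ d := by linarith
    have hdpos : 0 < d := by linarith
    have hP : polarT f (d⁻¹ • p) ≤ ENNReal.ofReal d⁻¹ := by
      refine polarT_le_ofReal (by positivity) fun w hw => ?_
      have h := hp w hw
      rw [inner_sub_left, real_inner_smul_left] at h
      rw [real_inner_smul_right]
      have : ⟪w, p⟫ ≤ d + (f w).toReal := by linarith
      calc d⁻¹ * ⟪w, p⟫ ≤ d⁻¹ * (d + (f w).toReal) := by gcongr
        _ = _ := by field_simp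
    have hPt : polarT f (d⁻¹ • p) ≠ ∞ := ne_top_of_le_ne_top (by simp) hP
    have hPr : (polarT f (d⁻¹ • p)).toReal ≤ d⁻¹ := by
      have := ENNReal.toReal_mono ENNReal.ofReal_ne_top hP
      rwa [ENNReal.toReal_ofReal (inv_nonneg.2 hdpos.le)] at this
    have hG := inner_sub_le_legendreT hPt hg
    rw [real_inner_smul_left, real_inner_smul_right, real_inner_comm] at hG
    have hG' : d⁻¹ * ((f x).toReal⁻¹ * b) - d⁻¹ ≤ G := le_trans (by linarith) hG
    have hkey : (2 - t) * d ≤ b - (f x).toReal := by nlinarith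
    have h3 : 2 - t ≤ d⁻¹ * (b - (f x).toReal) := by
      rw [le_inv_mul_iff₀ hdpos]
      linarith
    refine h3.trans (le_trans (le_of_eq ?_) (mul_le_mul_of_nonneg_left hG' ha.le))
    field_simp
  have hlim : Filter.Tendsto (fun t : ℝ => 2 - t) (𝓝[>] 1) (𝓝 1) := by
    have : Continuous fun t : ℝ => 2 - t := by fun_prop
    have h := (this.tendsto 1).mono_left (nhdsWithin_le_nhds (s := Ioi 1))
    norm_num at h
    exact h
  rw [inv_le_iff_one_le_mul₀' ha]
  exact le_of_tendsto hlim hev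

theorem GeomConvexOn.legendreT_polarT_inv_smul_self (hf : GeomConvexOn f) {x : Euc n}
    (hx : x ∈ interior {z | f z ≠ ∞}) (hfx : f x ≠ 0) (hlin : NotLinearPlus f x) :
    legendreT (polarT f) ((f x).toReal⁻¹ • x) = ENNReal.ofReal (f x).toReal⁻¹ := by
  have hxt : f x ≠ ∞ := interior_subset hx
  have hle := legendreT_polarT_inv_smul_le (ENNReal.toReal_pos hfx hxt) hxt le_rfl
  have hg := ne_top_of_le_ne_top ENNReal.ofReal_ne_top hle
  exact hle.antisymm <|
    (ENNReal.ofReal_le_iff_le_toReal hg).2 (hf.le_legendreT_polarT hx hfx hlin hg)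

/-- A bound on `⟪·, y⟫` by an affine function of `L (P f)` gives a bound by an affine function of
`f`, with the two coefficients exchanged. -/
theorem inner_le_of_forall_legendreT {y w : Euc n} {c d : ℝ} (hw : f w ≠ ∞)
    (h : ∀ z, legendreT (polarT f) z ≠ ∞ → ∀ s : ℝ, 0 ≤ s →
      (legendreT (polarT f) z).toReal ≤ s → ⟪z, y⟫ ≤ d * s + c) :
    ⟪w, y⟫ ≤ d + c * (f w).toReal := by
  have key : ∀ r ∈ Ioi (f w).toReal, ⟪w, y⟫ ≤ d + c * r := by
    intro r hr
    have hr0 : 0 < r := lt_of_le_of_lt ENNReal.toReal_nonneg hr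
    have hle := legendreT_polarT_inv_smul_le hr0 hw (le_of_lt hr)
    have hle' := ENNReal.toReal_mono ENNReal.ofReal_ne_top hle
    rw [ENNReal.toReal_ofReal (inv_nonneg.2 hr0.le)] at hle'
    have := h _ (ne_top_of_le_ne_top ENNReal.ofReal_ne_top hle) r⁻¹ (inv_nonneg.2 hr0.le) hle'
    rw [real_inner_smul_left, inv_mul_le_iff₀ hr0] at this
    refine this.trans (le_of_eq ?_)
    field_simp
  have hc : Continuous fun r : ℝ => d + c * r := by fun_prop
  exact ge_of_tendsto ((hc.tendsto _).mono_left nhdsWithin_le_nhds)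
    (Filter.eventually_of_mem self_mem_nhdsWithin key)

end Transforms

/-- Corollary 3.4: for `f ∈ Cvx₀(ℝⁿ)`, `x ∈ int(dom f)` with `f(x) ≠ 0` and `f` not linear
on `[0,x+]`: `∂°f(x) = ∂(Jf)(x/f(x))` and `∂°(Jf)(x/f(x)) = ∂f(x)`, where `Jf = L(Pf)`. -/
theorem stmt_7 {n : ℕ} (f : Euc n → ℝ≥0∞) (hf : GeomConvexOn f) (x : Euc n)
    (hx : x ∈ interior {z : Euc n | f z ≠ ∞}) (hfx : f x ≠ 0)
    (hlin : NotLinearPlus f x) :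
    polarSubdiff f x = subdiff (legendreT (polarT f)) ((f x).toReal⁻¹ • x) ∧
    polarSubdiff (legendreT (polarT f)) ((f x).toReal⁻¹ • x) = subdiff f x := by
  have hxt : f x ≠ ∞ := interior_subset hx
  have ha : 0 < (f x).toReal := ENNReal.toReal_pos hfx hxt
  have hgx := hf.legendreT_polarT_inv_smul_self hx hfx hlin
  have hgt : legendreT (polarT f) ((f x).toReal⁻¹ • x) ≠ ∞ := hgx ▸ ENNReal.ofReal_ne_top
  have hgr : (legendreT (polarT f) ((f x).toReal⁻¹ • x)).toReal = (f x).toReal⁻¹ := by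
    rw [hgx, ENNReal.toReal_ofReal (inv_nonneg.2 ha.le)]
  set g := legendreT (polarT f) with hg
  set a := (f x).toReal with haa
  constructor
  · ext y
    rw [mem_polarSubdiff_iff hxt, mem_subdiff_iff hgt, hgr, ← haa]
    constructor
    · rintro ⟨hy, hEq⟩ z hz
      have h := inner_sub_le_legendreT hy hz
      rw [real_inner_comm] at h
      have hP : (polarT f y).toReal = a⁻¹ * ⟪x, y⟫ - a⁻¹ := by
        field_simp
        linarith
      rw [inner_sub_left, real_inner_smul_left]
      linarith
    · intro h
      have h0 := h 0 (by simp [hg, legendreT_zero])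
      simp only [hg, legendreT_zero, ENNReal.toReal_zero, zero_sub, inner_neg_left,
        real_inner_smul_left] at h0
      have hP : polarT f y ≤ ENNReal.ofReal (a⁻¹ * ⟪x, y⟫ - a⁻¹) := by
        refine polarT_le_ofReal (by linarith) fun w hw => ?_
        refine inner_le_of_forall_legendreT hw fun z hz s _ hs => ?_
        have := h z hz
        rw [inner_sub_left, real_inner_smul_left] at this
        linarith
      have hPt : polarT f y ≠ ∞ := ne_top_of_le_ne_top ENNReal.ofReal_ne_top hP
      refine ⟨hPt, le_antisymm ?_ ?_⟩
      · have hP' := ENNReal.toReal_mono ENNReal.ofReal_ne_top hP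
        rw [ENNReal.toReal_ofReal (by linarith)] at hP'
        refine (mul_le_mul_of_nonneg_right hP' ha.le).trans (le_of_eq ?_)
        field_simp
      · have := inner_le_of_polarT_ne_top hPt hxt
        linarith
  · ext y
    rw [mem_polarSubdiff_iff hgt, mem_subdiff_iff hxt, hgr, ← haa, real_inner_smul_left]
    constructor
    · rintro ⟨hy, hEq⟩ w hw
      have hP : (polarT g y).toReal = ⟪x, y⟫ - a := by
        field_simp at hEq
        linarith
      have h : ⟪w, y⟫ ≤ (polarT g y).toReal + 1 * (f w).toReal :=
        inner_le_of_forall_legendreT hw fun z hz s _ hs => by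
          have h1 := inner_le_of_polarT_ne_top hy hz
          have h2 := mul_le_mul_of_nonneg_left hs (ENNReal.toReal_nonneg (a := polarT g y))
          linarith
      rw [inner_sub_left]
      linarith
    · intro h
      have h0 := h 0 (by simp [hf.2.2])
      simp only [hf.2.2, ENNReal.toReal_zero, zero_sub, inner_neg_left] at h0
      have hP : polarT g y ≤ ENNReal.ofReal (⟪x, y⟫ - a) := by
        refine polarT_le_ofReal (by linarith) fun z hz => ?_
        have key : ∀ c ∈ Ioi (⟪x, y⟫ - a), ⟪z, y⟫ ≤ 1 + c * (g z).toReal := by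
          intro c hc
          have hc0 : 0 < c := lt_of_le_of_lt (by linarith) hc
          simp only [mem_Ioi] at hc
          have hPu : polarT f (c⁻¹ • y) ≤ ENNReal.ofReal c⁻¹ := by
            refine polarT_le_ofReal (by positivity) fun w hw => ?_
            have h1 := h w hw
            rw [inner_sub_left] at h1
            rw [real_inner_smul_right, inv_mul_le_iff₀ hc0, mul_add, mul_inv_cancel_left₀ hc0.ne']
            linarith
          have hPt : polarT f (c⁻¹ • y) ≠ ∞ := ne_top_of_le_ne_top ENNReal.ofReal_ne_top hPu
          have hPr := ENNReal.toReal_mono ENNReal.ofReal_ne_top hPu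
          rw [ENNReal.toReal_ofReal (inv_nonneg.2 hc0.le)] at hPr
          have h2 := inner_sub_le_legendreT hPt hz
          rw [real_inner_smul_left, real_inner_comm] at h2
          have h3 : c⁻¹ * ⟪z, y⟫ ≤ (g z).toReal + c⁻¹ := by linarith
          rw [inv_mul_le_iff₀ hc0, mul_add, mul_inv_cancel₀ hc0.ne'] at h3
          linarith
        have hcont : Continuous fun c : ℝ => 1 + c * (g z).toReal := by fun_prop
        exact ge_of_tendsto ((hcont.tendsto _).mono_left nhdsWithin_le_nhds)
          (Filter.eventually_of_mem self_mem_nhdsWithin key)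
      have hPt : polarT g y ≠ ∞ := ne_top_of_le_ne_top ENNReal.ofReal_ne_top hP
      have hP' := ENNReal.toReal_mono ENNReal.ofReal_ne_top hP
      rw [ENNReal.toReal_ofReal (by linarith)] at hP'
      have h4 := inner_le_of_polarT_ne_top hPt hgt
      rw [hgr, real_inner_smul_left] at h4
      refine ⟨hPt, le_antisymm ?_ (by linarith)⟩
      refine (mul_le_mul_of_nonneg_right hP' (inv_nonneg.2 ha.le)).trans (le_of_eq ?_)
      field_simp
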